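/- Let T ∈ DCS(2,f) with γ₁₂ < 0 and γ₂₁ > 0. Then T has no fixed point in int ℝ₊², and for every x ∈ ℝ₊² with x₁ > 0, the orbit (Tᵏx)ₖ≥₀ converges to the axial fixed point q₍₁₎ = (1/μ₁₁, 0). -/

import Mathlib

open Set Filter Metric Topology Polynomial

/-- The class 𝓕 of C¹ growth functions `f(z,r)` defined on ℝ₊ × (0,∞),
bundled with the partial derivative `fz = ∂f/∂z`, satisfying
(i) f(r,r) = 1 and ∂f/∂z < 0, and (ii) f(z,r) + z ∂f/∂z(z,r) > 0. -/
structure GrowthF where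
  f : ℝ → ℝ → ℝ
  fz : ℝ → ℝ → ℝ
  smooth : ContDiffOn ℝ 1 (fun p : ℝ × ℝ => f p.1 p.2) (Set.Ici 0 ×ˢ Set.Ioi 0)
  hasDeriv : ∀ z r : ℝ, 0 ≤ z → 0 < r →
    HasDerivWithinAt (fun w => f w r) (fz z r) (Set.Ici 0) z
  pos : ∀ z r : ℝ, 0 ≤ z → 0 < r → 0 < f z r
  unit : ∀ r : ℝ, 0 < r → f r r = 1
  fz_neg : ∀ z r : ℝ, 0 ≤ z → 0 < r → fz z r < 0
  contest : ∀ z r : ℝ, 0 ≤ z → 0 < r → 0 < f z r + z * fz z r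

/-- The nonnegative cone ℝ₊ⁿ. -/
def orthant (n : ℕ) : Set (Fin n → ℝ) := {x | ∀ i, 0 ≤ x i}

/-- The open cone int ℝ₊ⁿ. -/
def intOrthant (n : ℕ) : Set (Fin n → ℝ) := {x | ∀ i, 0 < x i}

/-- The boundary ∂ℝ₊ⁿ = ℝ₊ⁿ \ int ℝ₊ⁿ. -/
def bdryOrthant (n : ℕ) : Set (Fin n → ℝ) := orthant n \ intOrthant n

/-- Fᵢ(x) = fᵢ(rᵢ Σⱼ μᵢⱼ xⱼ, rᵢ). -/
def DCS.F {n : ℕ} (fam : Fin n → GrowthF) (r : Fin n → ℝ) (μ : Fin n → Fin n → ℝ)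
    (i : Fin n) (x : Fin n → ℝ) : ℝ :=
  (fam i).f (r i * ∑ j, μ i j * x j) (r i)

/-- A map T of the class DCS(n,f): Tᵢ(x) = xᵢ fᵢ(rᵢ Σⱼ μᵢⱼ xⱼ, rᵢ) = xᵢ Fᵢ(x). -/
def DCS.map {n : ℕ} (fam : Fin n → GrowthF) (r : Fin n → ℝ) (μ : Fin n → Fin n → ℝ)
    (x : Fin n → ℝ) (i : Fin n) : ℝ :=
  x i * DCS.F fam r μ i x

/-- The Jacobian matrix DT(x): (DT(x))ᵢⱼ = δᵢⱼFᵢ(x) + xᵢ ∂fᵢ/∂z((RUx)ᵢ,rᵢ)·rᵢμᵢⱼ. -/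
def DCS.jac {n : ℕ} (fam : Fin n → GrowthF) (r : Fin n → ℝ) (μ : Fin n → Fin n → ℝ)
    (x : Fin n → ℝ) : Matrix (Fin n) (Fin n) ℝ :=
  Matrix.of fun i j => (if i = j then DCS.F fam r μ i x else 0)
    + x i * (fam i).fz (r i * ∑ k, μ i k * x k) (r i) * (r i * μ i j)

/-- T is permanent: there is a compact positively invariant set `K ⊆ int ℝ₊ⁿ`
absorbing every orbit starting in `int ℝ₊ⁿ`. -/
def Permanent {n : ℕ} (T : (Fin n → ℝ) → (Fin n → ℝ)) : Prop :=
  ∃ K : Set (Fin n → ℝ), IsCompact K ∧ K ⊆ intOrthant n ∧ T '' K ⊆ K ∧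
    ∀ x ∈ intOrthant n, ∃ m : ℕ, 0 < m ∧ ∀ k ≥ m, T^[k] x ∈ K

lemma GrowthF.cont (g : GrowthF) {r : ℝ} (hr : 0 < r) :
    ContinuousOn (fun w => g.f w r) (Set.Ici 0) := fun z hz =>
  (g.hasDeriv z r hz hr).continuousWithinAt

lemma GrowthF.derivAt (g : GrowthF) {r z : ℝ} (hr : 0 < r) (hz : 0 < z) :
    HasDerivAt (fun w => g.f w r) (g.fz z r) z :=
  (g.hasDeriv z r hz.le hr).hasDerivAt (Ici_mem_nhds hz)

lemma GrowthF.anti (g : GrowthF) {r : ℝ} (hr : 0 < r) :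
    StrictAntiOn (fun w => g.f w r) (Set.Ici 0) := by
  apply strictAntiOn_of_deriv_neg (convex_Ici 0) (g.cont hr)
  intro z hz
  rw [interior_Ici] at hz
  rw [(g.derivAt hr hz).deriv]
  exact g.fz_neg z r (le_of_lt hz) hr

lemma GrowthF.monoz (g : GrowthF) {r : ℝ} (hr : 0 < r) :
    StrictMonoOn (fun w => w * g.f w r) (Set.Ici 0) := by
  apply strictMonoOn_of_deriv_pos (convex_Ici 0) (continuousOn_id.mul (g.cont hr))
  intro z hz
  rw [interior_Ici] at hz
  have h := (hasDerivAt_id z).mul (g.derivAt hr hz)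
  have h2 : deriv (fun w => w * g.f w r) z = 1 * g.f z r + z * g.fz z r := h.deriv
  change 0 < deriv (fun w => w * g.f w r) z
  rw [h2, one_mul]
  exact g.contest z r (le_of_lt hz) hr

lemma GrowthF.mono1 (g : GrowthF) {r a x x' w w' : ℝ} (hr : 0 < r) (ha : 0 < a)
    (hx : 0 ≤ x) (hxx : x ≤ x') (hw : 0 ≤ w') (hww : w' ≤ w) :
    x * g.f (r * (a * x + w)) r ≤ x' * g.f (r * (a * x' + w')) r := by
  have hx' : 0 ≤ x' := hx.trans hxx
  have hax : 0 ≤ a * x := by positivity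
  have hax' : a * x ≤ a * x' := by gcongr
  rcases hx.eq_or_lt with h0 | h0
  · rw [← h0, zero_mul]
    exact mul_nonneg hx' (g.pos _ _ (by positivity) hr).le
  have h1 : g.f (r * (a * x + w)) r ≤ g.f (r * (a * x + w')) r := by
    apply (g.anti hr).antitoneOn
    · rw [Set.mem_Ici]
      positivity
    · rw [Set.mem_Ici]
      have : 0 ≤ w := hw.trans hww
      positivity
    · gcongr
  have hz : 0 < r * (a * x + w') := by positivity
  have hzz : r * (a * x + w') ≤ r * (a * x' + w') := by gcongr
  have h2 : r * (a * x + w') * g.f (r * (a * x + w')) r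
      ≤ r * (a * x' + w') * g.f (r * (a * x' + w')) r :=
    (g.monoz hr).monotoneOn hz.le (hz.le.trans hzz) hzz
  have h3 : x * (r * (a * x' + w')) ≤ x' * (r * (a * x + w')) := by
    have : x * w' * r ≤ x' * w' * r := by gcongr
    nlinarith
  have hf' : 0 < g.f (r * (a * x' + w')) r := g.pos _ _ (hz.le.trans hzz) hr
  refine (mul_le_mul_of_nonneg_left h1 hx).trans ?_
  refine le_of_mul_le_mul_right ?_ hz
  calc x * g.f (r * (a * x + w')) r * (r * (a * x + w'))
      = x * (r * (a * x + w') * g.f (r * (a * x + w')) r) := by ring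
    _ ≤ x * (r * (a * x' + w') * g.f (r * (a * x' + w')) r) := by gcongr
    _ = x * (r * (a * x' + w')) * g.f (r * (a * x' + w')) r := by ring
    _ ≤ x' * (r * (a * x + w')) * g.f (r * (a * x' + w')) r := by gcongr
    _ = _ := by ring

lemma GrowthF.le_one (g : GrowthF) {r s : ℝ} (hr : 0 < r) (hs : 1 ≤ s) :
    g.f (r * s) r ≤ 1 := by
  rw [← g.unit r hr]
  refine (g.anti hr).antitoneOn hr.le ?_ ?_
  · rw [Set.mem_Ici]
    positivity
  · nlinarith

lemma GrowthF.lt_one (g : GrowthF) {r s : ℝ} (hr : 0 < r) (hs : 1 < s) :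
    g.f (r * s) r < 1 := by
  rw [← g.unit r hr]
  refine g.anti hr hr.le ?_ ?_
  · rw [Set.mem_Ici]
    positivity
  · nlinarith

lemma GrowthF.one_le (g : GrowthF) {r s : ℝ} (hr : 0 < r) (h0 : 0 ≤ s) (hs : s ≤ 1) :
    1 ≤ g.f (r * s) r := by
  rw [← g.unit r hr]
  refine (g.anti hr).antitoneOn ?_ hr.le ?_
  · rw [Set.mem_Ici]
    positivity
  · nlinarith

lemma GrowthF.eq_one (g : GrowthF) {r s : ℝ} (hr : 0 < r) (h0 : 0 ≤ s)
    (h : g.f (r * s) r = 1) : s = 1 := by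
  rw [← g.unit r hr] at h
  have h1 : 0 ≤ r * s := by positivity
  have := (g.anti hr).injOn h1 hr.le h
  have h2 : r * (s - 1) = 0 := by linarith
  rcases mul_eq_zero.1 h2 with h | h <;> linarith

/-- Southeast order on the nonnegative quadrant. -/
def SELe (p q : Fin 2 → ℝ) : Prop := 0 ≤ p 0 ∧ p 0 ≤ q 0 ∧ 0 ≤ q 1 ∧ q 1 ≤ p 1

section
variable {fam : Fin 2 → GrowthF} {r : Fin 2 → ℝ} {μ : Fin 2 → Fin 2 → ℝ}

lemma map0 (p : Fin 2 → ℝ) : DCS.map fam r μ p 0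
    = p 0 * (fam 0).f (r 0 * (μ 0 0 * p 0 + μ 0 1 * p 1)) (r 0) := by
  simp [DCS.map, DCS.F, Fin.sum_univ_two]

lemma map1 (p : Fin 2 → ℝ) : DCS.map fam r μ p 1
    = p 1 * (fam 1).f (r 1 * (μ 1 1 * p 1 + μ 1 0 * p 0)) (r 1) := by
  simp [DCS.map, DCS.F, Fin.sum_univ_two, add_comm]

lemma map_mono (hr : ∀ i, 0 < r i) (hμ : ∀ i j, 0 < μ i j) {p q : Fin 2 → ℝ}
    (h : SELe p q) : SELe (DCS.map fam r μ p) (DCS.map fam r μ q) := by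
  obtain ⟨h1, h2, h3, h4⟩ := h
  have hq0 := h1.trans h2
  have hp1 := h3.trans h4
  have := hμ 0 0
  have := hμ 0 1
  have := hμ 1 0
  have := hμ 1 1
  have := hr 0
  have := hr 1
  refine ⟨?_, ?_, ?_, ?_⟩
  · rw [map0]
    exact mul_nonneg h1 ((fam 0).pos _ _ (by positivity) (hr 0)).le
  · rw [map0, map0]
    exact (fam 0).mono1 (hr 0) (hμ 0 0) h1 h2 (by positivity) (by gcongr)
  · rw [map1]
    exact mul_nonneg h3 ((fam 1).pos _ _ (by positivity) (hr 1)).le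
  · rw [map1, map1]
    exact (fam 1).mono1 (hr 1) (hμ 1 1) h3 h4 (by positivity) (by gcongr)

lemma iter_mono (hr : ∀ i, 0 < r i) (hμ : ∀ i j, 0 < μ i j) {p q : Fin 2 → ℝ}
    (h : SELe p q) (k : ℕ) : SELe ((DCS.map fam r μ)^[k] p) ((DCS.map fam r μ)^[k] q) := by
  induction k with
  | zero => exact h
  | succ k ih =>
    rw [Function.iterate_succ_apply', Function.iterate_succ_apply']
    exact map_mono hr hμ ih

lemma map_fix (hr : ∀ i, 0 < r i) (hμ : ∀ i j, 0 < μ i j)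
    (hγ12 : μ 0 0 - μ 1 0 < 0) (hγ21 : 0 < μ 1 1 - μ 0 1) {p : Fin 2 → ℝ}
    (h0 : 0 < p 0) (h1 : 0 ≤ p 1) (hp : DCS.map fam r μ p = p) :
    p 0 = 1 / μ 0 0 ∧ p 1 = 0 := by
  have := hμ 0 0
  have := hμ 0 1
  have := hμ 1 0
  have := hμ 1 1
  have e0 := congrFun hp 0
  have e1 := congrFun hp 1
  rw [map0] at e0
  rw [map1] at e1
  have s0 := (fam 0).eq_one (hr 0) (by positivity) ((mul_eq_left₀ h0.ne').1 e0)
  have hp1 : p 1 = 0 := by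
    by_contra hne
    have s1 := (fam 1).eq_one (hr 1) (by positivity) ((mul_eq_left₀ hne).1 e1)
    nlinarith
  refine ⟨?_, hp1⟩
  rw [hp1] at s0
  field_simp
  linarith

lemma orbit_lim (hr : ∀ i, 0 < r i) (hμ : ∀ i j, 0 < μ i j)
    (hγ12 : μ 0 0 - μ 1 0 < 0) (hγ21 : 0 < μ 1 1 - μ 0 1) {p q : Fin 2 → ℝ}
    (hnn : ∀ k i, 0 ≤ (DCS.map fam r μ)^[k] p i)
    (hl : ∀ i, Tendsto (fun k => (DCS.map fam r μ)^[k] p i) atTop (𝓝 (q i)))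
    (hq : 0 < q 0) :
    q 0 = 1 / μ 0 0 ∧ q 1 = 0 := by
  have hqn : ∀ i, 0 ≤ q i := fun i => ge_of_tendsto' (hl i) fun k => hnn k i
  apply map_fix hr hμ hγ12 hγ21 hq (hqn 1) (fam := fam) (r := r)
  funext i
  have h1 : Tendsto (fun k => (DCS.map fam r μ)^[k + 1] p i) atTop (𝓝 (q i)) :=
    (tendsto_add_atTop_iff_nat 1).2 (hl i)
  refine tendsto_nhds_unique ?_ h1
  have h2 : (fun k => (DCS.map fam r μ)^[k + 1] p i) =
      fun k => DCS.map fam r μ ((DCS.map fam r μ)^[k] p) i := by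
    funext k
    rw [Function.iterate_succ_apply']
  rw [h2]
  unfold DCS.map DCS.F
  refine (hl i).mul ?_
  have hnn' : ∀ x : Fin 2 → ℝ, (∀ i, 0 ≤ x i) → r i * ∑ j, μ i j * x j ∈ Set.Ici (0:ℝ) := by
    intro x hx
    exact mul_nonneg (hr i).le (Finset.sum_nonneg fun j _ => mul_nonneg (hμ i j).le (hx j))
  have hc := (fam i).cont (hr i) (r i * ∑ j, μ i j * q j) (hnn' q hqn)
  refine hc.tendsto.comp (tendsto_nhdsWithin_iff.2 ⟨?_, ?_⟩)
  · exact (tendsto_finsetSum _ fun j _ => (hl j).const_mul (μ i j)).const_mul (r i)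
  · exact Eventually.of_forall fun k => hnn' _ (hnn k)

lemma orbit_pos (hr : ∀ i, 0 < r i) (hμ : ∀ i j, 0 < μ i j) {x : Fin 2 → ℝ}
    (hx : x ∈ orthant 2) (hx0 : 0 < x 0) (k : ℕ) :
    0 < (DCS.map fam r μ)^[k] x 0 ∧ 0 ≤ (DCS.map fam r μ)^[k] x 1 := by
  have := hμ 0 0
  have := hμ 0 1
  have := hμ 1 0
  have := hμ 1 1
  have := hr 0
  have := hr 1
  induction k with
  | zero => exact ⟨hx0, hx 1⟩
  | succ k ih =>
    rw [Function.iterate_succ_apply', map0, map1]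
    obtain ⟨i0, i1⟩ := ih
    exact ⟨mul_pos i0 ((fam 0).pos _ _ (by positivity) (hr 0)),
      mul_nonneg i1 ((fam 1).pos _ _ (by positivity) (hr 1)).le⟩

lemma orbit_enter (hr : ∀ i, 0 < r i) (hμ : ∀ i j, 0 < μ i j) {x : Fin 2 → ℝ}
    (hx : x ∈ orthant 2) (hx0 : 0 < x 0) {N : ℝ} (hN0 : 0 < N) (hN : 1 < μ 1 1 * N) :
    ∃ k, (DCS.map fam r μ)^[k] x 1 < N := by
  by_contra! hcon
  have := hμ 1 0
  have := hμ 1 1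
  have := hr 1
  set q := (fam 1).f (r 1 * (μ 1 1 * N)) (r 1) with hq
  have hq1 : q < 1 := (fam 1).lt_one (hr 1) hN
  have hq0 : 0 < q := (fam 1).pos _ _ (by positivity) (hr 1)
  have key : ∀ k, (DCS.map fam r μ)^[k] x 1 ≤ q ^ k * x 1 := by
    intro k
    induction k with
    | zero => simp
    | succ k ih =>
      obtain ⟨i0, i1⟩ := orbit_pos (fam := fam) hr hμ hx hx0 k
      have hk := hcon k
      rw [Function.iterate_succ_apply', map1]
      have hf : (fam 1).f (r 1 * (μ 1 1 * (DCS.map fam r μ)^[k] x 1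
          + μ 1 0 * (DCS.map fam r μ)^[k] x 0)) (r 1) ≤ q := by
        apply ((fam 1).anti (hr 1)).antitoneOn
        · rw [Set.mem_Ici]
          positivity
        · rw [Set.mem_Ici]
          positivity
        · have : μ 1 1 * N ≤ μ 1 1 * (DCS.map fam r μ)^[k] x 1 := by gcongr
          have : 0 ≤ μ 1 0 * (DCS.map fam r μ)^[k] x 0 := by positivity
          gcongr
          linarith
      calc _ ≤ (q ^ k * x 1) * q := mul_le_mul ih hf ((fam 1).pos _ _ (by positivity) (hr 1)).le
              (i1.trans ih)
        _ = _ := by ring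
  have hlim : Tendsto (fun k => q ^ k * x 1) atTop (𝓝 (0 * x 1)) :=
    (tendsto_pow_atTop_nhds_zero_of_lt_one hq0.le hq1).mul_const _
  have := ge_of_tendsto' hlim fun k => (hcon k).trans (key k)
  rw [zero_mul] at this
  linarith

lemma conv_of_lt (hr : ∀ i, 0 < r i) (hμ : ∀ i j, 0 < μ i j)
    (hγ12 : μ 0 0 - μ 1 0 < 0) (hγ21 : 0 < μ 1 1 - μ 0 1) {x : Fin 2 → ℝ}
    (hx : x ∈ orthant 2) (hx0 : 0 < x 0) {N : ℝ} (hN0 : 0 < N) (hN : 1 < μ 1 1 * N)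
    (hN' : μ 0 1 * N < 1) (hxN : x 1 < N) :
    Tendsto (fun k => (DCS.map fam r μ)^[k] x) atTop (𝓝 (![1 / μ 0 0, 0])) := by
  have a0 := hμ 0 0
  have := hμ 0 1
  have := hμ 1 0
  have := hμ 1 1
  have hx1 := hx 1
  obtain ⟨ε, hε0, hεx, hεa⟩ : ∃ ε, 0 < ε ∧ ε ≤ x 0 ∧ μ 0 0 * ε + μ 0 1 * N ≤ 1 := by
    refine ⟨min (x 0) ((1 - μ 0 1 * N) / μ 0 0), lt_min hx0 (div_pos (by linarith) a0),
      min_le_left _ _, ?_⟩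
    have h := min_le_right (x 0) ((1 - μ 0 1 * N) / μ 0 0)
    rw [le_div_iff₀ a0] at h
    linarith
  obtain ⟨M, hMx, hMa⟩ : ∃ M, x 0 ≤ M ∧ 1 ≤ μ 0 0 * M := by
    refine ⟨max (x 0) (1 / μ 0 0), le_max_left _ _, ?_⟩
    have h := le_max_right (x 0) (1 / μ 0 0)
    rw [div_le_iff₀ a0] at h
    linarith
  set T := DCS.map fam r μ with hT
  set l : Fin 2 → ℝ := ![ε, N] with hl
  set u : Fin 2 → ℝ := ![M, 0] with hu
  have l0 : l 0 = ε := rfl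
  have l1 : l 1 = N := rfl
  have u0 : u 0 = M := rfl
  have u1 : u 1 = 0 := rfl
  have hM0 : 0 < M := hx0.trans_le hMx
  have hlx : SELe l x := ⟨by rw [l0]; exact hε0.le, hεx, hx1, hxN.le⟩
  have hxu : SELe x u := ⟨hx0.le, hMx, by rw [u1], by rw [u1]; exact hx1⟩
  have hlT : SELe l (T l) := by
    refine ⟨by rw [l0]; exact hε0.le, ?_, ?_, ?_⟩
    · rw [hT, map0, l0, l1]
      exact le_mul_of_one_le_right hε0.le ((fam 0).one_le (hr 0) (by positivity) hεa)
    · rw [hT, map1, l0, l1]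
      have := hr 1
      exact mul_nonneg hN0.le ((fam 1).pos _ _ (by positivity) (hr 1)).le
    · rw [hT, map1, l0, l1]
      have : 0 < μ 1 0 * ε := by positivity
      exact mul_le_of_le_one_right hN0.le ((fam 1).le_one (hr 1) (by linarith))
  have huT : SELe (T u) u := by
    refine ⟨?_, ?_, by rw [u1], ?_⟩
    · rw [hT, map0, u0, u1]
      have := hr 0
      exact mul_nonneg hM0.le ((fam 0).pos _ _ (by positivity) (hr 0)).le
    · rw [hT, map0, u0, u1]
      exact mul_le_of_le_one_right hM0.le ((fam 0).le_one (hr 0) (by linarith))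
    · rw [hT, map1, u1, zero_mul]
  have L := fun k => iter_mono (fam := fam) hr hμ hlx k
  have U := fun k => iter_mono (fam := fam) hr hμ hxu k
  have LS := fun k => iter_mono (fam := fam) hr hμ hlT k
  have US := fun k => iter_mono (fam := fam) hr hμ huT k
  simp only [← hT, ← Function.iterate_succ_apply] at L U LS US
  have Lm : Monotone fun k => T^[k] l 0 := monotone_nat_of_le_succ fun k => (LS k).2.1
  have La : Antitone fun k => T^[k] l 1 := antitone_nat_of_succ_le fun k => (LS k).2.2.2
  have Ua : Antitone fun k => T^[k] u 0 := antitone_nat_of_succ_le fun k => (US k).2.1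
  have Um : Monotone fun k => T^[k] u 1 := monotone_nat_of_le_succ fun k => (US k).2.2.2
  have hεL : ∀ k, ε ≤ T^[k] l 0 := fun k => Lm (Nat.zero_le k)
  have hLU : ∀ k, T^[k] l 0 ≤ T^[k] u 0 := fun k => (L k).2.1.trans (U k).2.1
  have hUL : ∀ k, T^[k] u 1 ≤ T^[k] l 1 := fun k => (U k).2.2.2.trans (L k).2.2.2
  have tl0 := tendsto_atTop_ciSup Lm ⟨M, by
    rintro _ ⟨k, rfl⟩
    exact (hLU k).trans (Ua (Nat.zero_le k))⟩
  have tl1 := tendsto_atTop_ciInf La ⟨0, by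
    rintro _ ⟨k, rfl⟩
    exact (L k).2.2.1.trans (L k).2.2.2⟩
  have tu0 := tendsto_atTop_ciInf Ua ⟨ε, by
    rintro _ ⟨k, rfl⟩
    exact (hεL k).trans (hLU k)⟩
  have tu1 := tendsto_atTop_ciSup Um ⟨N, by
    rintro _ ⟨k, rfl⟩
    exact (hUL k).trans (La (Nat.zero_le k))⟩
  have A := orbit_lim (fam := fam) hr hμ hγ12 hγ21 (p := l)
    (q := ![⨆ k, T^[k] l 0, ⨅ k, T^[k] l 1])
    (fun k i => by
      fin_cases i
      · exact (L k).1
      · exact (L k).2.2.1.trans (L k).2.2.2)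
    (fun i => by
      fin_cases i
      · exact tl0
      · exact tl1)
    (hε0.trans_le (ge_of_tendsto' tl0 hεL))
  have B := orbit_lim (fam := fam) hr hμ hγ12 hγ21 (p := u)
    (q := ![⨅ k, T^[k] u 0, ⨆ k, T^[k] u 1])
    (fun k i => by
      fin_cases i
      · exact (U k).1.trans (U k).2.1
      · exact (U k).2.2.1)
    (fun i => by
      fin_cases i
      · exact tu0
      · exact tu1)
    (hε0.trans_le (ge_of_tendsto' tu0 fun k => (hεL k).trans (hLU k)))
  simp only [Matrix.cons_val_zero, Matrix.cons_val_one] at A B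
  rw [A.1] at tl0
  rw [A.2] at tl1
  rw [B.1] at tu0
  rw [tendsto_pi_nhds]
  intro i
  fin_cases i
  · exact tendsto_of_tendsto_of_tendsto_of_le_of_le tl0 tu0 (fun k => (L k).2.1)
      fun k => (U k).2.1
  · exact tendsto_of_tendsto_of_tendsto_of_le_of_le tendsto_const_nhds tl1
      (fun k => (L k).2.2.1) fun k => (L k).2.2.2

end

/-- For T ∈ DCS(2,f) with γ₁₂ < 0 and γ₂₁ > 0: there is no
interior fixed point, and every orbit starting with x₁ > 0 converges to the
axial fixed point q₍₁₎ = (1/μ₁₁, 0). -/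
theorem stmt11 (fam : Fin 2 → GrowthF) (r : Fin 2 → ℝ) (μ : Fin 2 → Fin 2 → ℝ)
    (hr : ∀ i, 0 < r i) (hμ : ∀ i j, 0 < μ i j)
    (hγ12 : μ 0 0 - μ 1 0 < 0) (hγ21 : 0 < μ 1 1 - μ 0 1) :
    (∀ p ∈ intOrthant 2, DCS.map fam r μ p ≠ p) ∧
    (∀ x ∈ orthant 2, 0 < x 0 →
      Tendsto (fun k => (DCS.map fam r μ)^[k] x) atTop
        (𝓝 (![1 / μ 0 0, 0]))) := by
  refine ⟨?_, ?_⟩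
  · intro p hp h
    exact (hp 1).ne' (map_fix hr hμ hγ12 hγ21 (hp 0) (hp 1).le h).2
  · intro x hx hx0
    have b0 := hμ 0 1
    have d0 := hμ 1 1
    obtain ⟨N, h1, h2⟩ : ∃ N, 1 / μ 1 1 < N ∧ N < 1 / μ 0 1 :=
      exists_between (one_div_lt_one_div_of_lt b0 (by linarith))
    have hN0 : 0 < N := lt_trans (by positivity) h1
    rw [div_lt_iff₀ d0] at h1
    rw [lt_div_iff₀ b0] at h2
    have h1' : 1 < μ 1 1 * N := by linarith
    obtain ⟨k, hk⟩ := orbit_enter (fam := fam) hr hμ hx hx0 hN0 h1'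
    have hp := orbit_pos (fam := fam) hr hμ hx hx0 k
    have h := conv_of_lt (fam := fam) hr hμ hγ12 hγ21
      (x := (DCS.map fam r μ)^[k] x) (by
        intro i
        fin_cases i
        · exact hp.1.le
        · exact hp.2) hp.1 hN0 h1' (by linarith) hk
    rw [← tendsto_add_atTop_iff_nat k]
    simpa only [Function.iterate_add_apply] using h
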